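/- arXiv:1606.09016 — 5 statements merged into one kernel-verified Lean document; each statement's English description precedes it below -/
import Mathlib

section
/- The rewriting system 𝔖 of permutation diagrams terminates: there is no infinite sequence of words w_0 ⇒ w_1 ⇒ w_2 ⇒ … of rewriting steps; equivalently, the converse of the one-step rewriting relation ⇒ is well-founded. -/
/-!
Fix `n ≥ 1`; we write `n = m + 1` where `m : ℕ`, so that words are lists over the
alphabet `{s_1, …, s_{n-1}}`, formalized as `List (Fin m)`: the letter `i : Fin m`
denotes the adjacent transposition `(i, i+1)` of `Fin (m+1)`.
-/

/-- Words over the alphabet `{s_1, …, s_{n-1}}` with `n = m + 1`. -/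
abbrev Word (m : ℕ) := List (Fin m)

/-- The letter `s_i` as the adjacent transposition `(i, i+1)` of `{1, …, n}`. -/
def toSwap {m : ℕ} (i : Fin m) : Equiv.Perm (Fin (m + 1)) :=
  Equiv.swap i.castSucc i.succ

/-- Evaluation of a word: the composite of the transpositions taken in the order
in which they occur in the word (the leftmost letter is applied first). -/
def eval {m : ℕ} (w : Word m) : Equiv.Perm (Fin (m + 1)) :=
  (w.map toSwap).reverse.prod

/-- The interchange equivalence `≈`: the smallest congruence on words (compatible
with concatenation) generated by `s_i s_j ≈ s_j s_i` whenever `|i - j| ≥ 2`. -/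
inductive Interchange {m : ℕ} : Word m → Word m → Prop
  | swap (u v : Word m) (i j : Fin m)
      (h : (i : ℕ) + 2 ≤ (j : ℕ) ∨ (j : ℕ) + 2 ≤ (i : ℕ)) :
      Interchange (u ++ [i, j] ++ v) (u ++ [j, i] ++ v)
  | refl (w : Word m) : Interchange w w
  | symm {w w' : Word m} : Interchange w w' → Interchange w' w
  | trans {w₁ w₂ w₃ : Word m} :
      Interchange w₁ w₂ → Interchange w₂ w₃ → Interchange w₁ w₃

/-- The rules of the rewriting system `𝔖`:
`s_i s_i ⇒ ε` and `s_i s_{i+1} s_i ⇒ s_{i+1} s_i s_{i+1}`. -/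
inductive Rule {m : ℕ} : Word m → Word m → Prop
  | del (i : Fin m) : Rule [i, i] []
  | yb (i j : Fin m) (h : (j : ℕ) = (i : ℕ) + 1) : Rule [i, j, i] [j, i, j]

/-- One rewriting step of `𝔖`, applied inside an arbitrary context and modulo `≈`:
`w ⇒ w'` iff `w ≈ u·l·v` and `w' ≈ u·r·v` for some rule `l ⇒ r` and words `u, v`. -/
def Step {m : ℕ} (w w' : Word m) : Prop :=
  ∃ u v l r, Rule l r ∧ Interchange w (u ++ l ++ v) ∧ Interchange w' (u ++ r ++ v)

/-- The total weight of a word, the letter `i` having the positive weight `m - i`. -/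
def Word.weight {m : ℕ} (w : Word m) : ℕ :=
  (w.map fun i : Fin m => m - (i : ℕ)).sum

theorem Interchange.perm {m : ℕ} {w w' : Word m} (h : Interchange w w') : w.Perm w' := by
  induction h with
  | swap u v i j _ => exact ((List.Perm.swap j i []).append_left u).append_right v
  | refl w => exact .refl w
  | symm _ ih => exact ih.symm
  | trans _ _ ih₁ ih₂ => exact ih₁.trans ih₂

theorem Interchange.weight_eq {m : ℕ} {w w' : Word m} (h : Interchange w w') :
    w.weight = w'.weight :=
  (h.perm.map _).sum_eq

theorem Rule.weight_lt {m : ℕ} {l r : Word m} (h : Rule l r) : r.weight < l.weight := by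
  cases h with
  | del i => simp [Word.weight]
  | yb i j h =>
    simp only [Word.weight, List.map_cons, List.map_nil, List.sum_cons, List.sum_nil]
    omega

theorem Step.weight_lt {m : ℕ} {w w' : Word m} (h : Step w w') : w'.weight < w.weight := by
  obtain ⟨u, v, l, r, hlr, hw, hw'⟩ := h
  have hlt := hlr.weight_lt
  rw [hw.weight_eq, hw'.weight_eq]
  simp only [Word.weight, List.map_append, List.sum_append] at hlt ⊢
  omega

/-- The rewriting system `𝔖` terminates: there is no infinite
sequence `w_0 ⇒ w_1 ⇒ w_2 ⇒ …` of rewriting steps; equivalently, the converse of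
the one-step rewriting relation `⇒` is well-founded. -/
theorem step_terminates {m : ℕ} :
    (¬ ∃ f : ℕ → Word m, ∀ k, Step (f k) (f (k + 1))) ∧
      WellFounded (fun w w' : Word m => Step w' w) := by
  have hwf : WellFounded (fun w w' : Word m => Step w' w) :=
    Subrelation.wf Step.weight_lt (measure Word.weight).wf
  refine ⟨?_, hwf⟩
  rintro ⟨f, hf⟩
  exact (wellFounded_iff_isEmpty_descending_chain.mp hwf).false ⟨f, hf⟩
end

section
/- The monotone interpretation of permutation diagrams strictly decreases along rewriting: (a) if w ≈ w' then [w] = [w'] as functions ℕⁿ → ℕⁿ; (b) if w ⇒ w' is a rewriting step of 𝔖, then for every x ∈ ℕⁿ one has [w'](x) ≤ [w](x) in the componentwise (product) order, and whenever all coordinates of x are ≥ 1 the inequality is strict in at least one component. -/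
/-- The action of the letter `s_i` on `ℕⁿ`: it replaces the pair of coordinates
`(x_i, x_{i+1})` by `(x_i + x_{i+1}, x_i)` and leaves all other coordinates
unchanged. -/
def letterAct {m : ℕ} (i : Fin m) (x : Fin (m + 1) → ℕ) : Fin (m + 1) → ℕ :=
  fun k =>
    if k = i.castSucc then x i.castSucc + x i.succ
    else if k = i.succ then x i.castSucc
    else x k

/-- The monotone interpretation `[w] : ℕⁿ → ℕⁿ` of a word `w`, applying the
letters of `w` from left to right: `[ε] = id`, `[a·w] = [w] ∘ [a]`. -/
def act {m : ℕ} : Word m → (Fin (m + 1) → ℕ) → (Fin (m + 1) → ℕ)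
  | [] => id
  | a :: w => act w ∘ letterAct a

theorem letterAct_strictMono {m : ℕ} (i : Fin m) : StrictMono (letterAct i) := by
  refine Monotone.strictMono_of_injective (fun x y h k => ?_) (fun x y h => ?_)
  · have h₁ : x i.castSucc ≤ y i.castSucc := h _
    have h₂ : x i.succ ≤ y i.succ := h _
    have h₃ : x k ≤ y k := h _
    simp only [letterAct]
    split_ifs <;> omega
  · have h₁ := congrFun h i.castSucc
    have h₂ := congrFun h i.succ
    have hne : i.succ ≠ i.castSucc := Fin.castSucc_lt_succ.ne'
    simp only [letterAct, if_true, if_neg hne] at h₁ h₂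
    funext k
    have h₃ := congrFun h k
    unfold letterAct at h₃
    by_cases hk : k = i.castSucc
    · rw [hk, h₂]
    by_cases hk' : k = i.succ
    · rw [hk']
      omega
    simpa [hk, hk'] using h₃

theorem act_strictMono {m : ℕ} (w : Word m) : StrictMono (act w) := by
  induction w with
  | nil => exact strictMono_id
  | cons a w ih => exact ih.comp (letterAct_strictMono a)

theorem act_append {m : ℕ} (u v : Word m) (x : Fin (m + 1) → ℕ) :
    act (u ++ v) x = act v (act u x) := by
  induction u generalizing x with
  | nil => rfl
  | cons a u ih => exact ih _

theorem one_le_act {m : ℕ} (w : Word m) (x : Fin (m + 1) → ℕ) (hx : ∀ k, 1 ≤ x k) :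
    ∀ k, 1 ≤ act w x k := by
  induction w generalizing x with
  | nil => exact hx
  | cons a w ih =>
    refine ih _ fun k => ?_
    have h₁ := hx a.castSucc
    have h₂ := hx k
    unfold letterAct
    split_ifs <;> omega

theorem letterAct_comm {m : ℕ} {i j : Fin m}
    (h : (i : ℕ) + 2 ≤ (j : ℕ) ∨ (j : ℕ) + 2 ≤ (i : ℕ)) (x : Fin (m + 1) → ℕ) :
    letterAct j (letterAct i x) = letterAct i (letterAct j x) := by
  funext k
  simp only [letterAct, Fin.ext_iff, Fin.val_castSucc, Fin.val_succ]
  split_ifs <;> first | rfl | omega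

theorem Interchange.act_eq {m : ℕ} {w w' : Word m} (h : Interchange w w') :
    act w = act w' := by
  induction h with
  | swap u v i j h =>
    funext x
    simp only [act_append]
    exact congrArg (act v) (letterAct_comm h _)
  | refl => rfl
  | symm _ ih => exact ih.symm
  | trans _ _ ih₁ ih₂ => exact ih₁.trans ih₂

theorem Rule.act_le {m : ℕ} {l r : Word m} (h : Rule l r) (x : Fin (m + 1) → ℕ) :
    act r x ≤ act l x := by
  intro k
  cases h with
  | del i =>
    have hne : i.succ ≠ i.castSucc := Fin.castSucc_lt_succ.ne'
    simp only [act, letterAct, Function.comp, id, if_true, if_neg hne]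
    split_ifs with h₁ h₂
    · subst h₁
      omega
    · subst h₂
      omega
    · exact le_rfl
  | yb i j h =>
    have hj : j.castSucc = i.succ := Fin.ext (by simpa using h)
    have h₁ : i.succ ≠ i.castSucc := Fin.castSucc_lt_succ.ne'
    have h₂ : j.succ ≠ i.succ := by simp [Fin.ext_iff]; omega
    have h₃ : j.succ ≠ i.castSucc := by simp [Fin.ext_iff]; omega
    simp only [act, letterAct, Function.comp, id, hj, if_true, if_neg h₁, if_neg h₁.symm,
      if_neg h₂, if_neg h₂.symm, if_neg h₃, if_neg h₃.symm]
    split_ifs <;> grind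

theorem Rule.act_lt {m : ℕ} {l r : Word m} (h : Rule l r) (x : Fin (m + 1) → ℕ)
    (hx : ∀ k, 1 ≤ x k) : act r x < act l x := by
  refine Pi.lt_def.mpr ⟨h.act_le x, ?_⟩
  cases h with
  | del i =>
    have hne : i.succ ≠ i.castSucc := Fin.castSucc_lt_succ.ne'
    have := hx i.castSucc
    refine ⟨i.succ, ?_⟩
    simp only [act, letterAct, Function.comp, id, if_true, if_neg hne]
    omega
  | yb i j h =>
    have hj : j.castSucc = i.succ := Fin.ext (by simpa using h)
    have h₁ : i.succ ≠ i.castSucc := Fin.castSucc_lt_succ.ne'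
    have h₂ : j.succ ≠ i.succ := by simp [Fin.ext_iff]; omega
    have h₃ : j.succ ≠ i.castSucc := by simp [Fin.ext_iff]; omega
    have := hx i.castSucc
    refine ⟨i.castSucc, ?_⟩
    simp only [act, letterAct, Function.comp, id, hj, if_true, if_neg h₁, if_neg h₁.symm,
      if_neg h₂, if_neg h₂.symm, if_neg h₃, if_neg h₃.symm]
    omega

/-- The monotone interpretation strictly decreases along
rewriting: (a) if `w ≈ w'` then `[w] = [w']`; (b) if `w ⇒ w'` then for every
`x ∈ ℕⁿ` one has `[w'] x ≤ [w] x` componentwise, and whenever all coordinates of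
`x` are `≥ 1` the inequality is strict in at least one component. -/
theorem act_decreasing {m : ℕ} :
    (∀ w w' : Word m, Interchange w w' → act w = act w') ∧
      (∀ w w' : Word m, Step w w' → ∀ x : Fin (m + 1) → ℕ,
        (∀ k, act w' x k ≤ act w x k) ∧
          ((∀ k, 1 ≤ x k) → ∃ k, act w' x k < act w x k)) := by
  refine ⟨fun w w' h => h.act_eq, ?_⟩
  rintro w w' ⟨u, v, l, r, hr, hw, hw'⟩ x
  rw [hw.act_eq, hw'.act_eq]
  simp only [act_append]
  exact ⟨(act_strictMono v).monotone (hr.act_le _), fun hx =>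
    (Pi.lt_def.mp (act_strictMono v (hr.act_lt _ (one_le_act u x hx)))).2⟩
end

section
/- The rewriting system 𝔖 of permutation diagrams is confluent: if w ⇒* w₁ and w ⇒* w₂, then there exists a word w' such that w₁ ⇒* w' and w₂ ⇒* w', where ⇒* denotes the reflexive–transitive closure of the union of the one-step rewriting relation ⇒ and the interchange equivalence ≈. -/
/-- `⇒*`: the reflexive–transitive closure of the union of the one-step
rewriting relation `⇒` and the interchange equivalence `≈`. -/
def StepStar {m : ℕ} : Word m → Word m → Prop :=
  Relation.ReflTransGen (fun w w' => Step w w' ∨ Interchange w w')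

theorem eval_append {m : ℕ} (w w' : Word m) : eval (w ++ w') = eval w' * eval w := by
  simp [eval]

theorem eval_cons {m : ℕ} (i : Fin m) (w : Word m) : eval (i :: w) = eval w * toSwap i := by
  simp [eval]

theorem eval_singleton {m : ℕ} (i : Fin m) : eval [i] = toSwap i := by
  simp [eval]

namespace Interchange

theorem context {m : ℕ} {w w' : Word m} (h : Interchange w w') (p q : Word m) :
    Interchange (p ++ w ++ q) (p ++ w' ++ q) := by
  induction h with
  | swap u v i j h => simpa using Interchange.swap (p ++ u) (v ++ q) i j h
  | refl w => exact .refl _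
  | symm _ ih => exact ih.symm
  | trans _ _ ih₁ ih₂ => exact ih₁.trans ih₂

theorem map_succ {m : ℕ} {w w' : Word m} (h : Interchange w w') :
    Interchange (w.map Fin.succ) (w'.map Fin.succ) := by
  induction h with
  | swap u v i j h =>
    simpa using Interchange.swap (u.map Fin.succ) (v.map Fin.succ) i.succ j.succ
      (by simp only [Fin.val_succ]; omega)
  | refl w => exact .refl _
  | symm _ ih => exact ih.symm
  | trans _ _ ih₁ ih₂ => exact ih₁.trans ih₂

/-- A letter commutes with every word all of whose letters are far from it. -/
theorem append_singleton {m : ℕ} (i : Fin m) (w : Word m)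
    (h : ∀ j ∈ w, (i : ℕ) + 2 ≤ (j : ℕ) ∨ (j : ℕ) + 2 ≤ (i : ℕ)) :
    Interchange (w ++ [i]) (i :: w) := by
  induction w with
  | nil => exact .refl _
  | cons j w ih =>
    have h₁ := (ih fun k hk => h k (by simp [hk])).context [j] []
    have h₂ := Interchange.swap [] w j i (h j (by simp)).symm
    simp only [List.append_nil, List.nil_append, List.cons_append] at h₁ h₂
    exact h₁.trans h₂

theorem eval_eq {m : ℕ} {w w' : Word m} (h : Interchange w w') : eval w = eval w' := by
  induction h with
  | swap u v i j h =>
    have hd : Equiv.Perm.Disjoint (toSwap j) (toSwap i) := by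
      refine Equiv.Perm.disjoint_swap_swap ?_
      simp [Fin.ext_iff]
      omega
    have : eval [i, j] = eval [j, i] := by
      simpa [eval] using hd.commute.eq
    simp only [eval_append, this]
  | refl w => rfl
  | symm _ ih => exact ih.symm
  | trans _ _ ih₁ ih₂ => exact ih₁.trans ih₂

end Interchange

namespace Rule

theorem map_succ {m : ℕ} {l r : Word m} (h : Rule l r) :
    Rule (l.map Fin.succ) (r.map Fin.succ) := by
  cases h with
  | del i => exact .del _
  | yb i j h => exact .yb _ _ (by simp [h])

theorem eval_eq {m : ℕ} {l r : Word m} (h : Rule l r) : eval l = eval r := by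
  cases h with
  | del i => simp [eval, toSwap]
  | yb i j h =>
    have hij : j.castSucc = i.succ := Fin.ext (by simp [h])
    have h₁ : i.castSucc ≠ i.succ := by simp [Fin.ext_iff]
    have h₂ : i.castSucc ≠ j.succ := by simp [Fin.ext_iff]; omega
    have h₃ : i.succ ≠ j.succ := by simp [Fin.ext_iff]; omega
    have h₄ := Equiv.swap_mul_swap_mul_swap h₃.symm h₂.symm
    rw [Equiv.swap_comm i.succ, Equiv.swap_comm j.succ, Equiv.swap_comm i.castSucc j.succ] at h₄
    have h₅ := h₄.trans (Equiv.swap_mul_swap_mul_swap h₁ h₂).symm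
    simpa [eval, toSwap, hij, mul_assoc] using h₅

end Rule

namespace StepStar

theorem refl {m : ℕ} (w : Word m) : StepStar w w :=
  Relation.ReflTransGen.refl

theorem trans {m : ℕ} {w₁ w₂ w₃ : Word m} (h₁ : StepStar w₁ w₂) (h₂ : StepStar w₂ w₃) :
    StepStar w₁ w₃ :=
  Relation.ReflTransGen.trans h₁ h₂

theorem of_interchange {m : ℕ} {w w' : Word m} (h : Interchange w w') : StepStar w w' :=
  Relation.ReflTransGen.single (.inr h)

theorem of_rule {m : ℕ} {l r : Word m} (h : Rule l r) (u v : Word m) :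
    StepStar (u ++ l ++ v) (u ++ r ++ v) :=
  Relation.ReflTransGen.single (.inl ⟨u, v, l, r, h, .refl _, .refl _⟩)

theorem context {m : ℕ} {w w' : Word m} (h : StepStar w w') (p q : Word m) :
    StepStar (p ++ w ++ q) (p ++ w' ++ q) := by
  refine Relation.ReflTransGen.lift (fun w => p ++ w ++ q) ?_ _ _ h
  rintro a b (⟨u, v, l, r, hr, ha, hb⟩ | h)
  · exact .inl ⟨p ++ u, v ++ q, l, r, hr, by simpa using ha.context p q,
      by simpa using hb.context p q⟩
  · exact .inr (h.context p q)

theorem map_succ {m : ℕ} {w w' : Word m} (h : StepStar w w') :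
    StepStar (w.map Fin.succ) (w'.map Fin.succ) := by
  refine Relation.ReflTransGen.lift (List.map Fin.succ) ?_ _ _ h
  rintro a b (⟨u, v, l, r, hr, ha, hb⟩ | h)
  · exact .inl ⟨u.map Fin.succ, v.map Fin.succ, _, _, hr.map_succ, by simpa using ha.map_succ,
      by simpa using hb.map_succ⟩
  · exact .inr h.map_succ

theorem eval_eq {m : ℕ} {w w' : Word m} (h : StepStar w w') : eval w = eval w' := by
  induction h with
  | refl => rfl
  | tail _ h ih =>
    rw [ih]
    rcases h with ⟨u, v, l, r, hr, ha, hb⟩ | h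
    · rw [ha.eval_eq, hb.eval_eq]
      simp only [eval_append, hr.eval_eq]
    · exact h.eval_eq

end StepStar

/-- The ascending word consisting of the first `j` letters. -/
def ascending (m j : ℕ) : Word m :=
  (List.finRange m).take j

theorem ascending_succ {m j : ℕ} (h : j < m) :
    ascending m (j + 1) = ascending m j ++ [⟨j, h⟩] := by
  simp [ascending, List.take_add_one, h]

theorem val_lt_of_mem_ascending {m j : ℕ} {i : Fin m} (h : i ∈ ascending m j) : (i : ℕ) < j := by
  obtain ⟨k, hk, rfl⟩ := List.mem_iff_getElem.1 h
  simp only [ascending, List.length_take] at hk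
  simp only [ascending, List.getElem_take, List.getElem_finRange, Fin.val_cast]
  omega

theorem eval_ascending_zero {m j : ℕ} (h : j ≤ m) :
    eval (ascending m j) 0 = ⟨j, by omega⟩ := by
  induction j with
  | zero => rfl
  | succ j ih =>
    rw [ascending_succ h, eval_append, Equiv.Perm.mul_apply, ih (by omega), eval_singleton]
    exact Equiv.swap_apply_left _ _

theorem eval_map_succ_zero {m : ℕ} (w : Word m) : eval (w.map Fin.succ) 0 = 0 := by
  induction w with
  | nil => rfl
  | cons i w ih =>
    rw [List.map_cons, eval_cons, Equiv.Perm.mul_apply, toSwap, Equiv.swap_apply_of_ne_of_ne, ih]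
    all_goals simp [Fin.ext_iff]

theorem eval_map_succ_succ {m : ℕ} (w : Word m) (x : Fin (m + 1)) :
    eval (w.map Fin.succ) x.succ = (eval w x).succ := by
  induction w generalizing x with
  | nil => rfl
  | cons i w ih =>
    rw [List.map_cons, eval_cons, eval_cons, Equiv.Perm.mul_apply, Equiv.Perm.mul_apply,
      ← ih, toSwap, toSwap, ← Fin.succ_castSucc,
      (Fin.succ_injective _).swap_apply]

/-- A letter other than the last one of an ascending word passes through that word from right to
left, and becomes the next letter. -/
theorem stepStar_ascending_append {m j : ℕ} (hj : j ≤ m) (i k : Fin m) (hik : (k : ℕ) = i + 1)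
    (h : (k : ℕ) < j) : StepStar (ascending m j ++ [i]) (k :: ascending m j) := by
  induction j with
  | zero => omega
  | succ j ih =>
    rw [ascending_succ hj]
    rcases Nat.lt_succ_iff_lt_or_eq.1 h with h | rfl
    · have h₁ := Interchange.swap (ascending m j) [] ⟨j, hj⟩ i (by simp only; omega)
      have h₂ := (ih (by omega) h).context [] [⟨j, hj⟩]
      simp only [List.append_assoc, List.cons_append, List.nil_append, List.append_nil] at h₁ h₂ ⊢
      exact (StepStar.of_interchange h₁).trans h₂
    · have hk : ascending m k = ascending m i ++ [i] := by rw [hik, ascending_succ i.2]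
      have h₁ := StepStar.of_rule (Rule.yb i k hik) (ascending m i) []
      have h₂ := (Interchange.append_singleton k (ascending m i) fun a ha => by
        have := val_lt_of_mem_ascending ha
        omega).context [] [i, k]
      simp only [List.append_assoc, List.cons_append, List.nil_append, List.append_nil,
        hk] at h₁ h₂ ⊢
      exact h₁.trans (StepStar.of_interchange h₂)

/-- Canonical words: a canonical word in the letters above the first one, followed by an
ascending word. -/
def IsCanonical : (m : ℕ) → Word m → Prop
  | 0, w => w = []
  | m + 1, w => ∃ u, IsCanonical m u ∧ ∃ j ≤ m + 1, w = u.map Fin.succ ++ ascending (m + 1) j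

theorem isCanonical_nil (m : ℕ) : IsCanonical m [] := by
  induction m with
  | zero => rfl
  | succ m ih => exact ⟨[], ih, 0, by omega, rfl⟩

theorem IsCanonical.exists_stepStar_append {m : ℕ} {w : Word m} (hw : IsCanonical m w)
    (i : Fin m) : ∃ w', IsCanonical m w' ∧ StepStar (w ++ [i]) w' := by
  induction m with
  | zero => exact i.elim0
  | succ m ih =>
    obtain ⟨u, hu, j, hj, rfl⟩ := hw
    have move (k : Fin m)
        (hk : StepStar (ascending (m + 1) j ++ [i]) (k.succ :: ascending (m + 1) j)) :
        ∃ w', IsCanonical (m + 1) w' ∧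
          StepStar (u.map Fin.succ ++ ascending (m + 1) j ++ [i]) w' := by
      obtain ⟨u', hu', h⟩ := ih hu k
      refine ⟨_, ⟨u', hu', j, hj, rfl⟩, ?_⟩
      have h₁ := hk.context (u.map Fin.succ) []
      have h₂ := h.map_succ.context [] (ascending (m + 1) j)
      simp only [List.append_assoc, List.cons_append, List.nil_append, List.append_nil,
        List.map_append, List.map_cons, List.map_nil] at h₁ h₂ ⊢
      exact h₁.trans h₂
    obtain h | rfl | h | h : j < i ∨ j = i ∨ j = i + 1 ∨ (i : ℕ) + 1 < j := by omega
    · refine move (i.pred (by rintro rfl; simp at h)) ?_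
      rw [Fin.succ_pred]
      refine .of_interchange (.append_singleton _ _ fun a ha => ?_)
      have := val_lt_of_mem_ascending ha
      omega
    · exact ⟨_, ⟨u, hu, i + 1, i.2, rfl⟩, by
        rw [ascending_succ i.2, List.append_assoc]
        exact .refl _⟩
    · subst h
      refine ⟨_, ⟨u, hu, i, by omega, rfl⟩, ?_⟩
      have := StepStar.of_rule (Rule.del i) (u.map Fin.succ ++ ascending (m + 1) i) []
      simpa [ascending_succ i.2] using this
    · exact move ⟨i, by omega⟩ (stepStar_ascending_append hj _ _ rfl h)

theorem exists_isCanonical_stepStar {m : ℕ} (w : Word m) :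
    ∃ w', IsCanonical m w' ∧ StepStar w w' := by
  induction w using List.reverseRecOn with
  | nil => exact ⟨[], isCanonical_nil m, .refl _⟩
  | append_singleton w i ih =>
    obtain ⟨c, hc, h⟩ := ih
    obtain ⟨c', hc', h'⟩ := hc.exists_stepStar_append i
    exact ⟨c', hc', (by simpa using h.context [] [i] : StepStar (w ++ [i]) (c ++ [i])).trans h'⟩

theorem IsCanonical.eq_of_eval_eq {m : ℕ} {w w' : Word m} (hw : IsCanonical m w)
    (hw' : IsCanonical m w') (h : eval w = eval w') : w = w' := by
  induction m with
  | zero => exact hw.trans hw'.symm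
  | succ m ih =>
    obtain ⟨u, hu, j, hj, rfl⟩ := hw
    obtain ⟨u', hu', j', hj', rfl⟩ := hw'
    rw [eval_append, eval_append] at h
    have h₀ := Equiv.congr_fun h 0
    rw [Equiv.Perm.mul_apply, Equiv.Perm.mul_apply, eval_map_succ_zero, eval_map_succ_zero,
      eval_ascending_zero hj, eval_ascending_zero hj', Fin.mk.injEq] at h₀
    subst h₀
    have h₁ : u = u' := ih hu hu' <| Equiv.ext fun x => Fin.succ_injective _ <| by
      rw [← eval_map_succ_succ, ← eval_map_succ_succ, mul_left_cancel h]
    rw [h₁]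

/-- The rewriting system `𝔖` is confluent: if `w ⇒* w₁` and
`w ⇒* w₂`, then there exists a word `w'` such that `w₁ ⇒* w'` and `w₂ ⇒* w'`. -/
theorem step_confluent {m : ℕ} (w w₁ w₂ : Word m)
    (h₁ : StepStar w w₁) (h₂ : StepStar w w₂) :
    ∃ w' : Word m, StepStar w₁ w' ∧ StepStar w₂ w' := by
  obtain ⟨c₁, hc₁, hs₁⟩ := exists_isCanonical_stepStar w₁
  obtain ⟨c₂, hc₂, hs₂⟩ := exists_isCanonical_stepStar w₂
  have : c₁ = c₂ := hc₁.eq_of_eval_eq hc₂ <| by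
    rw [← hs₁.eval_eq, ← hs₂.eval_eq, ← h₁.eval_eq, ← h₂.eval_eq]
  exact ⟨c₁, hs₁, this ▸ hs₂⟩
end

section
/- Interpretation of proofs in Σ_MLL: for every list of MLL formulas Γ, if the sequent ⊢ Γ is derivable in MLL, then there exists a proof diagram from the empty word to Γ, i.e. the empty word rewrites to the word Γ in the system Σ_MLL. -/
/-- MLL formulas: generated from a countable set of atoms `a` and their duals
`a⊥` by the binary connectives `⊗` and `⅋`. -/
inductive MLLFormula : Type
  | pos : ℕ → MLLFormula          -- an atom `a`
  | neg : ℕ → MLLFormula          -- a dual atom `a⊥`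
  | tensor : MLLFormula → MLLFormula → MLLFormula
  | parr : MLLFormula → MLLFormula → MLLFormula

namespace MLLFormula

/-- Linear negation: the involution with `(a)⊥ = a⊥`, `(a⊥)⊥ = a`,
`(A⊗B)⊥ = B⊥ ⅋ A⊥` and `(A⅋B)⊥ = B⊥ ⊗ A⊥`. -/
def dual : MLLFormula → MLLFormula
  | pos a => neg a
  | neg a => pos a
  | tensor A B => parr (dual B) (dual A)
  | parr A B => tensor (dual B) (dual A)

end MLLFormula

/-- MLL derivability `⊢ Γ`, the least predicate closed under the rules `Ax`,
`Cut`, `⊗`, `⅋` and exchange. -/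
inductive MLLProof : List MLLFormula → Prop
  | ax (A : MLLFormula) : MLLProof [A, A.dual]
  | cut (S Γ : List MLLFormula) (A : MLLFormula) :
      MLLProof (S ++ [A]) → MLLProof (Γ ++ [A.dual]) → MLLProof (S ++ Γ)
  | tensor (S Γ : List MLLFormula) (A B : MLLFormula) :
      MLLProof (S ++ [A]) → MLLProof (B :: Γ) →
      MLLProof (S ++ [A.tensor B] ++ Γ)
  | parr (S : List MLLFormula) (A B : MLLFormula) :
      MLLProof (S ++ [A, B]) → MLLProof (S ++ [A.parr B])
  | exchange (Γ Γ' : List MLLFormula) :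
      MLLProof Γ → Γ.Perm Γ' → MLLProof Γ'

/-- One rewriting step for a set `gen` of generators: replace, inside an
arbitrary context, a contiguous factor matching a generator's source by its
target. -/
def CtxStep {α : Type} (gen : List α → List α → Prop) (w w' : List α) : Prop :=
  ∃ u v l r, gen l r ∧ w = u ++ l ++ v ∧ w' = u ++ r ++ v

/-- The generators of the system `Σ_MLL`. -/
inductive MLLGen : List MLLFormula → List MLLFormula → Prop
  | ax (A : MLLFormula) : MLLGen [] [A, A.dual]
  | tensor (A B : MLLFormula) : MLLGen [A, B] [A.tensor B]
  | parr (A B : MLLFormula) : MLLGen [A, B] [A.parr B]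
  | cut (A : MLLFormula) : MLLGen [A, A.dual] []
  | swap (A B : MLLFormula) : MLLGen [A, B] [B, A]

open Relation in
/-- The rewriting relation is closed under contexts. -/
theorem CtxStep.reflTransGen_context {α : Type} {gen : List α → List α → Prop}
    {w w' : List α} (h : ReflTransGen (CtxStep gen) w w') (u v : List α) :
    ReflTransGen (CtxStep gen) (u ++ w ++ v) (u ++ w' ++ v) := by
  refine h.lift (fun x => u ++ x ++ v) ?_
  rintro _ _ ⟨u', v', l, r, hg, rfl, rfl⟩
  exact ⟨u ++ u', v' ++ v, l, r, hg, by simp, by simp⟩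

open Relation in
theorem MLLGen.reflTransGen_context {l r : List MLLFormula} (h : MLLGen l r)
    (u v : List MLLFormula) :
    ReflTransGen (CtxStep MLLGen) (u ++ l ++ v) (u ++ r ++ v) :=
  .single ⟨u, v, l, r, h, rfl, rfl⟩

open Relation in
/-- Permutations of a word are realised by swaps. -/
theorem MLLGen.reflTransGen_of_perm {w w' : List MLLFormula} (h : w.Perm w') :
    ReflTransGen (CtxStep MLLGen) w w' := by
  induction h with
  | nil => exact .refl
  | cons x _ ih => simpa using CtxStep.reflTransGen_context ih [x] []
  | swap x y l => simpa using (MLLGen.swap y x).reflTransGen_context [] l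
  | trans _ _ ih₁ ih₂ => exact ih₁.trans ih₂

open Relation in
/-- Juxtaposition of two proof diagrams. -/
theorem CtxStep.reflTransGen_append {α : Type} {gen : List α → List α → Prop}
    {w w' : List α} (h : ReflTransGen (CtxStep gen) [] w)
    (h' : ReflTransGen (CtxStep gen) [] w') :
    ReflTransGen (CtxStep gen) [] (w ++ w') :=
  h.trans (by simpa using CtxStep.reflTransGen_context h' w [])

/-- Interpretation of proofs in `Σ_MLL`: if `⊢ Γ` is derivable
in MLL, then the empty word rewrites to the word `Γ` in the system `Σ_MLL`. -/
theorem mll_interpretation (Γ : List MLLFormula) (h : MLLProof Γ) :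
    Relation.ReflTransGen (CtxStep MLLGen) [] Γ := by
  induction h with
  | ax A => simpa using (MLLGen.ax A).reflTransGen_context [] []
  | cut S Γ A _ _ ih₁ ih₂ =>
    have hperm : ((S ++ [A]) ++ (Γ ++ [A.dual])).Perm (S ++ [A, A.dual] ++ Γ) := by
      simpa only [List.append_assoc, List.cons_append, List.nil_append] using
        ((List.perm_append_singleton A.dual Γ).cons A).append_left S
    have hcut := (MLLGen.cut A).reflTransGen_context S Γ
    rw [List.append_nil] at hcut
    exact ((CtxStep.reflTransGen_append ih₁ ih₂).trans
      (MLLGen.reflTransGen_of_perm hperm)).trans hcut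
  | tensor S Γ A B _ _ ih₁ ih₂ =>
    refine (CtxStep.reflTransGen_append ih₁ ih₂).trans ?_
    simpa using (MLLGen.tensor A B).reflTransGen_context S Γ
  | parr S A B _ ih =>
    exact ih.trans (by simpa using (MLLGen.parr A B).reflTransGen_context S [])
  | exchange Γ Γ' _ hperm ih => exact ih.trans (MLLGen.reflTransGen_of_perm hperm)
end

section
/- Proof diagram correspondence for MLL with units and control: for every list of MLLc formulas Γ, the sequent ⊢ Γ is derivable in MLLc (multiplicative linear logic with units) if and only if there exists a controlled proof diagram from the empty word to the word L, Γ, R, i.e. the empty word rewrites to L, Γ, R in the control system Σ̃_MLLu. -/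
/-- MLLc formulas: generated from a countable set of atoms `a` and their duals
`a⊥`, the units `1` and `⊥`, and the binary connectives `⊗` and `⅋`. -/
inductive MLLcFormula : Type
  | pos : ℕ → MLLcFormula          -- an atom `a`
  | neg : ℕ → MLLcFormula          -- a dual atom `a⊥`
  | one : MLLcFormula              -- the unit `1`
  | bot : MLLcFormula              -- the unit `⊥`
  | tensor : MLLcFormula → MLLcFormula → MLLcFormula
  | parr : MLLcFormula → MLLcFormula → MLLcFormula

namespace MLLcFormula

/-- Linear negation: the involution with `(a)⊥ = a⊥`, `(a⊥)⊥ = a`, `1⊥ = ⊥`,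
`⊥⊥ = 1`, `(A⊗B)⊥ = B⊥ ⅋ A⊥` and `(A⅋B)⊥ = B⊥ ⊗ A⊥`. -/
def dual : MLLcFormula → MLLcFormula
  | pos a => neg a
  | neg a => pos a
  | one => bot
  | bot => one
  | tensor A B => parr (dual B) (dual A)
  | parr A B => tensor (dual B) (dual A)

end MLLcFormula

/-- MLLc derivability `⊢ Γ`, the least predicate closed under the rules `Ax`,
`Cut`, `⊗`, `⅋`, `1`, `⊥` and exchange. -/
inductive MLLcProof : List MLLcFormula → Prop
  | ax (A : MLLcFormula) : MLLcProof [A, A.dual]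
  | cut (S Γ : List MLLcFormula) (A : MLLcFormula) :
      MLLcProof (S ++ [A]) → MLLcProof (Γ ++ [A.dual]) → MLLcProof (S ++ Γ)
  | tensor (S Γ : List MLLcFormula) (A B : MLLcFormula) :
      MLLcProof (S ++ [A]) → MLLcProof (B :: Γ) →
      MLLcProof (S ++ [A.tensor B] ++ Γ)
  | parr (S : List MLLcFormula) (A B : MLLcFormula) :
      MLLcProof (S ++ [A, B]) → MLLcProof (S ++ [A.parr B])
  | one : MLLcProof [MLLcFormula.one]
  | bot (S : List MLLcFormula) : MLLcProof S → MLLcProof (S ++ [MLLcFormula.bot])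
  | exchange (Γ Γ' : List MLLcFormula) :
      MLLcProof Γ → Γ.Perm Γ' → MLLcProof Γ'

/-- Labels: MLLc formulas together with the two control colors `L` and `R`. -/
inductive MLLcLabel : Type
  | fm : MLLcFormula → MLLcLabel
  | L : MLLcLabel
  | R : MLLcLabel

/-- The generators of the control system `Σ̃_MLLu` (the colors `L` and `R` are
never swapped). -/
inductive CtrlGenU : List MLLcLabel → List MLLcLabel → Prop
  | ax (A : MLLcFormula) :
      CtrlGenU [] [.L, .fm A, .fm A.dual, .R]
  | tensor (A B : MLLcFormula) :
      CtrlGenU [.fm A, .R, .L, .fm B] [.fm (A.tensor B)]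
  | parr (A B : MLLcFormula) :
      CtrlGenU [.fm A, .fm B] [.fm (A.parr B)]
  | cut (A : MLLcFormula) :
      CtrlGenU [.fm A, .R, .L, .fm A.dual] []
  | swap (A B : MLLcFormula) :
      CtrlGenU [.fm A, .fm B] [.fm B, .fm A]
  | one : CtrlGenU [] [.L, .fm MLLcFormula.one, .R]
  | bot : CtrlGenU [] [.fm MLLcFormula.bot]

namespace CtxStep

variable {α : Type} {gen : List α → List α → Prop}

theorem of_gen {l r : List α} (h : gen l r) (u v : List α) :
    CtxStep gen (u ++ l ++ v) (u ++ r ++ v) :=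
  ⟨u, v, l, r, h, rfl, rfl⟩

theorem append_context {w w' : List α} (h : CtxStep gen w w') (x y : List α) :
    CtxStep gen (x ++ w ++ y) (x ++ w' ++ y) := by
  obtain ⟨u, v, l, r, hg, rfl, rfl⟩ := h
  exact ⟨x ++ u, v ++ y, l, r, hg, by simp, by simp⟩

theorem reflTransGen_append_context {w w' : List α}
    (h : Relation.ReflTransGen (CtxStep gen) w w') (x y : List α) :
    Relation.ReflTransGen (CtxStep gen) (x ++ w ++ y) (x ++ w' ++ y) :=
  h.lift (fun z => x ++ z ++ y) fun _ _ hs => hs.append_context x y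

end CtxStep

namespace MLLcLabel

open Relation

/-- Formulas can be permuted by rewriting. -/
theorem reflTransGen_map_of_perm {Γ Γ' : List MLLcFormula} (h : Γ.Perm Γ') :
    ReflTransGen (CtxStep CtrlGenU) (Γ.map fm) (Γ'.map fm) := by
  induction h with
  | nil => exact .refl
  | cons A _ ih => simpa using CtxStep.reflTransGen_append_context ih [fm A] []
  | swap A B Γ => exact .single (by simpa using CtxStep.of_gen (CtrlGenU.swap B A) [] (Γ.map fm))
  | trans _ _ ih₁ ih₂ => exact ih₁.trans ih₂

theorem reflTransGen_block_of_perm {Γ Γ' : List MLLcFormula} (h : Γ.Perm Γ') :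
    ReflTransGen (CtxStep CtrlGenU) (L :: Γ.map fm ++ [R]) (L :: Γ'.map fm ++ [R]) := by
  simpa using CtxStep.reflTransGen_append_context (reflTransGen_map_of_perm h) [L] [R]

theorem reflTransGen_append {w w' : List MLLcLabel}
    (h : ReflTransGen (CtxStep CtrlGenU) [] w) (h' : ReflTransGen (CtxStep CtrlGenU) [] w') :
    ReflTransGen (CtxStep CtrlGenU) [] (w ++ w') :=
  h.trans (by simpa using CtxStep.reflTransGen_append_context h' w [])

theorem reflTransGen_of_proof {Γ : List MLLcFormula} (h : MLLcProof Γ) :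
    ReflTransGen (CtxStep CtrlGenU) [] (L :: Γ.map fm ++ [R]) := by
  induction h with
  | ax A => exact .single (by simpa using CtxStep.of_gen (CtrlGenU.ax A) [] [])
  | cut S Γ A _ _ ih₁ ih₂ =>
    refine (reflTransGen_append ih₁ (ih₂.trans
      (reflTransGen_block_of_perm (Γ' := A.dual :: Γ) (by simp)))).tail ?_
    simpa using CtxStep.of_gen (CtrlGenU.cut A) (L :: S.map fm) (Γ.map fm ++ [R])
  | tensor S Γ A B _ _ ih₁ ih₂ =>
    refine (reflTransGen_append ih₁ ih₂).tail ?_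
    simpa using CtxStep.of_gen (CtrlGenU.tensor A B) (L :: S.map fm) (Γ.map fm ++ [R])
  | parr S A B _ ih =>
    exact ih.tail (by simpa using CtxStep.of_gen (CtrlGenU.parr A B) (L :: S.map fm) [R])
  | one => exact .single (by simpa using CtxStep.of_gen CtrlGenU.one [] [])
  | bot S _ ih => exact ih.tail (by simpa using CtxStep.of_gen CtrlGenU.bot (L :: S.map fm) [R])
  | exchange _ _ _ hp ih => exact ih.trans (reflTransGen_block_of_perm hp)

/-- `Balanced h w`: reading `L` as opening and `R` as closing parentheses, the word `w` closes
exactly `h` pending parentheses. -/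
def Balanced : ℕ → List MLLcLabel → Prop
  | h, [] => h = 0
  | h, fm _ :: w => Balanced h w
  | h, L :: w => Balanced (h + 1) w
  | 0, R :: _ => False
  | h + 1, R :: w => Balanced h w

/-- `Blocks P none w`: the word `w` is a concatenation of blocks `L, Γ, R` with `P Γ`.
`Blocks P (some Δ) w`: the word `L, Δ, w` is such a concatenation. -/
def Blocks (P : List MLLcFormula → Prop) : Option (List MLLcFormula) → List MLLcLabel → Prop
  | none, [] => True
  | none, L :: w => Blocks P (some []) w
  | some Δ, fm A :: w => Blocks P (some (Δ ++ [A])) w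
  | some Δ, R :: w => P Δ ∧ Blocks P none w
  | _, _ => False

/-- The number of pending `L` in a state of `Blocks`. -/
def openCount : Option (List MLLcFormula) → ℕ
  | none => 0
  | some _ => 1

theorem Balanced.rewrite {l r : List MLLcLabel} (hg : CtrlGenU l r) (u v : List MLLcLabel) (h : ℕ)
    (hb : Balanced h (u ++ l ++ v)) : Balanced h (u ++ r ++ v) := by
  induction u generalizing h with
  | nil => cases hg <;> cases h <;> simp_all [Balanced]
  | cons c u ih => cases c <;> cases h <;> simp_all [Balanced]

theorem Blocks.mono_acc {P : List MLLcFormula → Prop} {Δ Δ' : List MLLcFormula}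
    (hP : ∀ Θ, P (Δ ++ Θ) → P (Δ' ++ Θ)) {w : List MLLcLabel} (h : Blocks P (some Δ) w) :
    Blocks P (some Δ') w := by
  induction w generalizing Δ Δ' with
  | nil => simp [Blocks] at h
  | cons c w ih =>
    cases c with
    | fm A => exact ih (fun Θ => by simpa using hP ([A] ++ Θ)) h
    | L => simp [Blocks] at h
    | R => exact ⟨by simpa using hP [] (by simpa using h.1), h.2⟩

/-- A balanced word rewriting in one step to a concatenation of blocks is itself one. -/
theorem Blocks.of_rewrite {l r : List MLLcLabel} (hg : CtrlGenU l r) (u v : List MLLcLabel)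
    (s : Option (List MLLcFormula)) (hb : Balanced (openCount s) (u ++ l ++ v))
    (h : Blocks (fun _ => True) s (u ++ r ++ v)) : Blocks (fun _ => True) s (u ++ l ++ v) := by
  induction u generalizing s with
  | nil =>
    cases s with
    | none => cases hg <;> simp_all [Blocks, Balanced, openCount]
    | some Δ =>
      cases hg <;> simp only [List.nil_append, List.cons_append, Blocks, true_and] at h ⊢ <;>
        exact h.mono_acc fun _ _ => trivial
  | cons c u ih =>
    cases c <;> cases s <;> simp_all [Blocks, Balanced, openCount]

theorem Blocks.rewrite {l r : List MLLcLabel} (hg : CtrlGenU l r) (u v : List MLLcLabel)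
    (s : Option (List MLLcFormula)) (h : Blocks MLLcProof s (u ++ l ++ v))
    (h' : Blocks (fun _ => True) s (u ++ r ++ v)) : Blocks MLLcProof s (u ++ r ++ v) := by
  induction u generalizing s with
  | nil =>
    cases s with
    | none =>
      cases hg <;> simp only [List.nil_append, List.cons_append, Blocks] at h h' ⊢
      case ax A => exact ⟨.ax A, h⟩
      case one => exact ⟨.one, h⟩
    | some Δ =>
      cases hg <;> simp only [List.nil_append, List.cons_append, Blocks] at h h' ⊢
      case tensor A B => exact h.2.mono_acc fun Θ hΘ => .tensor Δ Θ A B h.1 hΘ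
      case parr A B =>
        refine h.mono_acc fun Θ hΘ => .exchange (Δ ++ Θ ++ [A.parr B]) _ (.parr _ A B
          (.exchange _ _ hΘ ?_)) ?_
        · simpa using (List.perm_append_comm (l₁ := [A, B]) (l₂ := Θ)).append_left Δ
        · simpa using (List.perm_append_singleton (A.parr B) Θ).append_left Δ
      case cut A =>
        exact h.2.mono_acc fun Θ hΘ => .cut Δ Θ A h.1
          (.exchange _ _ hΘ (List.perm_append_singleton A.dual Θ).symm)
      case swap A B =>
        refine h.mono_acc fun Θ hΘ => .exchange _ _ hΘ ?_
        simpa using (List.Perm.swap B A Θ).append_left Δ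
      case bot =>
        refine h.mono_acc fun Θ hΘ => .exchange _ _ (.bot _ hΘ) ?_
        simpa using (List.perm_append_singleton MLLcFormula.bot Θ).append_left Δ
  | cons c u ih =>
    cases c <;> cases s <;> simp_all [Blocks]

theorem balanced_and_blocks {w : List MLLcLabel} (h : ReflTransGen (CtxStep CtrlGenU) [] w) :
    Balanced 0 w ∧ (Blocks (fun _ => True) none w → Blocks MLLcProof none w) := by
  induction h with
  | refl => simp [Balanced, Blocks]
  | tail _ hs ih =>
    obtain ⟨u, v, l, r, hg, rfl, rfl⟩ := hs
    exact ⟨ih.1.rewrite hg u v 0,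
      fun h' => (ih.2 (h'.of_rewrite hg u v none ih.1)).rewrite hg u v none h'⟩

theorem blocks_map_append {P : List MLLcFormula → Prop} (Δ Γ : List MLLcFormula) :
    Blocks P (some Δ) (Γ.map fm ++ [R]) ↔ P (Δ ++ Γ) := by
  induction Γ generalizing Δ with
  | nil => simp [Blocks]
  | cons A Γ ih => simpa [Blocks] using ih (Δ ++ [A])

theorem proof_of_reflTransGen {Γ : List MLLcFormula}
    (h : ReflTransGen (CtxStep CtrlGenU) [] (L :: Γ.map fm ++ [R])) : MLLcProof Γ :=
  (blocks_map_append [] Γ).1 ((balanced_and_blocks h).2 ((blocks_map_append [] Γ).2 trivial))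

end MLLcLabel

/-- Proof diagram correspondence for MLL with units and
control: `⊢ Γ` is derivable in MLLc if and only if the empty word rewrites to
`L, Γ, R` in the control system `Σ̃_MLLu`. -/
theorem mllu_control_correspondence (Γ : List MLLcFormula) :
    MLLcProof Γ ↔
      Relation.ReflTransGen (CtxStep CtrlGenU) []
        (MLLcLabel.L :: Γ.map MLLcLabel.fm ++ [MLLcLabel.R]) := by
  exact ⟨MLLcLabel.reflTransGen_of_proof, MLLcLabel.proof_of_reflTransGen⟩
end
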